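/- Let I ⊆ Π be μ-connected. Then F_I is contained in the union, over all μ-connected subsets K ⊆ I, of the sets μ − ℝ_>K; moreover the sets μ − ℝ_>K for distinct subsets K ⊆ Π are pairwise disjoint. -/

import Mathlib

open Set Module

noncomputable section

/-- The linear reflection `x ↦ x - f x • a` associated to a vector `a` and a linear
functional `f` with `f a = 2`, bundled as a linear automorphism. -/
def reflEquiv {V : Type*} [AddCommGroup V] [Module ℝ V]
    (a : V) (f : V →ₗ[ℝ] ℝ) (h2 : f a = 2) : V ≃ₗ[ℝ] V :=
  LinearEquiv.ofInvolutive (LinearMap.id - f.smulRight a)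
    (fun x => by
      simp only [LinearMap.sub_apply, LinearMap.id_apply, LinearMap.smulRight_apply,
        map_sub, map_smul, smul_eq_mul, h2]
      module)

/-- A realization over `ℝ` of an `m × m` generalized Cartan matrix `A`:
simple roots `α_i`, simple coroots `α_i∨` (as linear functionals), with
`⟨α_j, α_i∨⟩ = a_{ij}`, together with the defining axioms. -/
structure GCMRealization (m : ℕ) (V : Type*) [NormedAddCommGroup V] [NormedSpace ℝ V] where
  A : Matrix (Fin m) (Fin m) ℤ
  root : Fin m → V
  coroot : Fin m → V →ₗ[ℝ] ℝ
  one_le_m : 1 ≤ m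
  A_diag : ∀ i, A i i = 2
  A_offdiag : ∀ i j, i ≠ j → A i j ≤ 0
  A_zero_iff : ∀ i j, A i j = 0 ↔ A j i = 0
  root_indep : LinearIndependent ℝ root
  coroot_indep : LinearIndependent ℝ coroot
  pairing : ∀ i j, coroot i (root j) = (A i j : ℝ)
  finDim : FiniteDimensional ℝ V
  dim_eq : finrank ℝ V + (A.map ((↑) : ℤ → ℝ)).rank = 2 * m

/-- A face of a convex set `H`: a convex subset `F ⊆ H` such that whenever the open
segment between two points of `H` meets `F`, both points lie in `F`. -/
def IsFaceOf {V : Type*} [NormedAddCommGroup V] [NormedSpace ℝ V] (H F : Set V) : Prop :=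
  Convex ℝ F ∧ IsExtreme ℝ H F

namespace GCMRealization

variable {m : ℕ} {V : Type*} [NormedAddCommGroup V] [NormedSpace ℝ V]
variable (S : GCMRealization m V)

/-- The fundamental reflection `r_i`. -/
def s (i : Fin m) : V ≃ₗ[ℝ] V :=
  reflEquiv (S.root i) (S.coroot i) (by
    have h := S.pairing i i
    rw [S.A_diag i] at h
    simpa using h)

/-- The Weyl group `W`, as a subgroup of the group of linear automorphisms of `V`. -/
def W : Subgroup (V ≃ₗ[ℝ] V) := Subgroup.closure (Set.range S.s)

/-- The standard parabolic subgroup `W_I` generated by the reflections indexed by `I`. -/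
def WI (I : Set (Fin m)) : Subgroup (V ≃ₗ[ℝ] V) := Subgroup.closure (S.s '' I)

/-- The closed fundamental chamber `C̄`. -/
def chamber : Set V := {η | ∀ i, 0 ≤ S.coroot i η}

/-- `J₀`: the set of indices `i` with `⟨μ, α_i∨⟩ = 0`. -/
def J0 (μ : V) : Set (Fin m) := {i | S.coroot i μ = 0}

/-- The orbit of `μ` under a subgroup of linear automorphisms. -/
def orbitOf (G : Subgroup (V ≃ₗ[ℝ] V)) (μ : V) : Set V :=
  (fun w : V ≃ₗ[ℝ] V => w μ) '' (G : Set (V ≃ₗ[ℝ] V))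

/-- `F_I`: the convex hull of `W_I · μ`. -/
def face (μ : V) (I : Set (Fin m)) : Set V := convexHull ℝ (orbitOf (S.WI I) μ)

/-- `H`: the convex hull of the Weyl group orbit of `μ`. -/
def orbitHull (μ : V) : Set V := convexHull ℝ (orbitOf S.W μ)

/-- `ℝ₊I`: the set of nonnegative linear combinations of the simple roots indexed by `I`. -/
def coneNonneg (I : Set (Fin m)) : Set V :=
  {v | ∃ c : Fin m → ℝ, (∀ i, 0 ≤ c i) ∧ (∀ i, i ∉ I → c i = 0) ∧ v = ∑ i, c i • S.root i}

/-- `ℝ_>I`: the set of strictly positive linear combinations of the simple roots indexed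
by `I` (with `ℝ_>∅ = {0}`). -/
def conePos (I : Set (Fin m)) : Set V :=
  {v | ∃ c : Fin m → ℝ, (∀ i ∈ I, 0 < c i) ∧ (∀ i, i ∉ I → c i = 0) ∧ v = ∑ i, c i • S.root i}

/-- The open standard facet `C_J`. -/
def openFacet (J : Set (Fin m)) : Set V :=
  {η | (∀ i ∈ J, S.coroot i η = 0) ∧ ∀ i, i ∉ J → 0 < S.coroot i η}

/-- The closed standard facet `C̄_J`. -/
def closedFacet (J : Set (Fin m)) : Set V :=
  {η | (∀ i ∈ J, S.coroot i η = 0) ∧ ∀ i, i ∉ J → 0 ≤ S.coroot i η}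

/-- Adjacency of two vertices of the Dynkin diagram: `i ≠ j` and `a_{ij} ≠ 0`
(equivalently `a_{ji} ≠ 0`). -/
def Adjacent (i j : Fin m) : Prop := i ≠ j ∧ S.A i j ≠ 0 ∧ S.A j i ≠ 0

/-- The Dynkin diagram, as a simple graph on the index set. -/
def diagram : SimpleGraph (Fin m) where
  Adj := S.Adjacent
  symm := ⟨fun _ _ h => ⟨h.1.symm, h.2.2, h.2.1⟩⟩
  loopless := ⟨fun _ h => h.1 rfl⟩

/-- A subset `I` is `μ`-connected if every connected component of `I` meets
`J_> = Π \ J₀` (the empty set is `μ`-connected). -/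
def MuConnected (μ : V) (I : Set (Fin m)) : Prop :=
  ∀ i : I, ∃ j : I, S.coroot (j : Fin m) μ ≠ 0 ∧ (S.diagram.induce I).Reachable i j

/-- The connected component of `i` inside `K`, as a subset of the index set. -/
def comp (K : Set (Fin m)) (i : Fin m) : Set (Fin m) :=
  {j | ∃ (hi : i ∈ K) (hj : j ∈ K), (S.diagram.induce K).Reachable ⟨i, hi⟩ ⟨j, hj⟩}

/-- `I*`: the largest `μ`-connected subset of `I`, i.e. the union of the connected
components of `I` that meet `J_>`. -/
def muPart (μ : V) (I : Set (Fin m)) : Set (Fin m) :=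
  {j | ∃ (hj : j ∈ I) (k : Fin m) (hk : k ∈ I), S.coroot k μ ≠ 0 ∧
    (S.diagram.induce I).Reachable ⟨j, hj⟩ ⟨k, hk⟩}

/-- `I_*`: the set of `α ∈ J₀ \ I` orthogonal to all of `I`. -/
def starSet (μ : V) (I : Set (Fin m)) : Set (Fin m) :=
  {i | S.coroot i μ = 0 ∧ i ∉ I ∧ ∀ j ∈ I, S.coroot i (S.root j) = 0}

/-- A subset `K ⊆ Π` is of finite type if the subgroup `W_K` is finite. -/
def FiniteType (K : Set (Fin m)) : Prop := ((S.WI K : Subgroup (V ≃ₗ[ℝ] V)) : Set (V ≃ₗ[ℝ] V)).Finite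

/-- Every connected component of `K` is of finite type. -/
def FinTypeComponents (K : Set (Fin m)) : Prop := ∀ i ∈ K, S.FiniteType (S.comp K i)

/-- A fundamental face of `H`: a face which is empty or whose relative interior meets
the fundamental chamber. -/
def IsFundFace (μ : V) (F : Set V) : Prop :=
  IsFaceOf (S.orbitHull μ) F ∧ (F = ∅ ∨ (intrinsicInterior ℝ F ∩ S.chamber).Nonempty)

/-- The length of `w ∈ W` with respect to the fundamental reflections. -/
def len (w : V ≃ₗ[ℝ] V) : ℕ :=
  sInf {k | ∃ l : List (Fin m), l.length = k ∧ w = (l.map S.s).prod}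

end GCMRealization

end

namespace GCMRealization

variable {m : ℕ} {V : Type*} [NormedAddCommGroup V] [NormedSpace ℝ V]
variable (S : GCMRealization m V)

lemma s7_s_apply (i : Fin m) (x : V) : S.s i x = x - S.coroot i x • S.root i := rfl

lemma s7_pair_self (i : Fin m) : S.coroot i (S.root i) = 2 := by
  rw [S.pairing, S.A_diag]; norm_num

lemma s7_s_s (i : Fin m) (x : V) : S.s i (S.s i x) = x := by
  simp only [s7_s_apply, map_sub, map_smul, smul_eq_mul, s7_pair_self]
  module

lemma s7_coroot_s_self (i : Fin m) (x : V) : S.coroot i (S.s i x) = - S.coroot i x := by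
  simp only [s7_s_apply, map_sub, map_smul, smul_eq_mul, s7_pair_self]; ring

lemma s7_coroot_s (i j : Fin m) (x : V) :
    S.coroot i (S.s j x) = S.coroot i x - S.A i j * S.coroot j x := by
  simp only [s7_s_apply, map_sub, map_smul, smul_eq_mul, S.pairing]; ring

/-- `λ` is obtained from `μ` by applying `n` reflections indexed by `I`. -/
inductive S7Reach (I : Set (Fin m)) (μ : V) : ℕ → V → Prop
  | zero : S7Reach I μ 0 μ
  | succ {n : ℕ} {x : V} (i : Fin m) (hi : i ∈ I) (h : S7Reach I μ n x) :
      S7Reach I μ (n + 1) (S.s i x)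

/-- Alternating product of `k` reflections, leftmost `i`, applied to `x`. -/
def s7alt : Fin m → Fin m → ℕ → V → V
  | _, _, 0, x => x
  | i, j, (k + 1), x => S.s i (s7alt j i k x)

lemma s7alt_zero (i j : Fin m) (x : V) : S.s7alt i j 0 x = x := rfl

lemma s7alt_succ (i j : Fin m) (k : ℕ) (x : V) :
    S.s7alt i j (k + 1) x = S.s i (S.s7alt j i k x) := rfl

lemma s7_reach_alt {I : Set (Fin m)} {μ : V} {n : ℕ} {x : V} (h : S.S7Reach I μ n x) (k : ℕ) :
    ∀ {i j : Fin m}, i ∈ I → j ∈ I → S.S7Reach I μ (n + k) (S.s7alt i j k x) := by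
  induction k with
  | zero => intro i j _ _; exact h
  | succ k ih => intro i j hi hj; exact S7Reach.succ i hi (ih hj hi)

lemma s7alt_add (k r : ℕ) (x : V) : ∀ i j : Fin m, ∃ i' j' : Fin m,
    (i' = i ∧ j' = j ∨ i' = j ∧ j' = i) ∧
    S.s7alt i j (k + r) x = S.s7alt i j k (S.s7alt i' j' r x) := by
  induction k with
  | zero => intro i j; exact ⟨i, j, Or.inl ⟨rfl, rfl⟩, by simp [s7alt_zero]⟩
  | succ k ih =>
    intro i j
    obtain ⟨i', j', h, e⟩ := ih j i
    refine ⟨i', j', h.symm, ?_⟩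
    rw [show k + 1 + r = (k + r) + 1 by ring, s7alt_succ, e, s7alt_succ]

/-- The letter-wise right extension of an alternating product. -/
lemma s7alt_right (k : ℕ) : ∀ i j : Fin m, ∃ t t' : Fin m,
    (t = i ∧ t' = j ∨ t = j ∧ t' = i) ∧
    (∀ x, S.s7alt i j (k + 1) x = S.s7alt i j k (S.s t x)) ∧
    (∀ x, S.s7alt i j (k + 2) x = S.s7alt i j (k + 1) (S.s t' x)) := by
  induction k with
  | zero => intro i j; exact ⟨i, j, Or.inl ⟨rfl, rfl⟩, fun x => rfl, fun x => rfl⟩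
  | succ k ih =>
    intro i j
    obtain ⟨t, t', h, e, e'⟩ := ih j i
    refine ⟨t, t', h.symm, fun x => ?_, fun x => ?_⟩
    · rw [s7alt_succ, e, s7alt_succ]
    · rw [s7alt_succ, e']; rfl

/-- Rank two, infinite case. -/
lemma s7_rank2_inf {i j : Fin m} {a b : ℝ} (ha : (S.A i j : ℝ) = -a) (hb : (S.A j i : ℝ) = -b)
    (ha0 : 0 ≤ a) (hb0 : 0 ≤ b) (hab : 4 ≤ a * b) {x : V}
    (hp : 0 ≤ S.coroot i x) (hq : 0 ≤ S.coroot j x) (k : ℕ) :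
    0 ≤ S.coroot i (S.s7alt j i k x) ∧ 0 ≤ S.coroot j (S.s7alt i j k x) ∧
    a * S.coroot j (S.s7alt i j k x) ≤ 2 * S.coroot i (S.s7alt j i (k + 1) x) ∧
    b * S.coroot i (S.s7alt j i k x) ≤ 2 * S.coroot j (S.s7alt i j (k + 1) x) := by
  induction k with
  | zero =>
    simp only [s7alt_succ, s7alt_zero, s7_coroot_s, ha, hb]
    refine ⟨hp, hq, ?_, ?_⟩
    · nlinarith [mul_nonneg ha0 hq]
    · nlinarith [mul_nonneg hb0 hp]
  | succ k ih =>
    obtain ⟨h1, h2, h3, h4⟩ := ih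
    have eX : S.coroot i (S.s7alt j i (k + 2) x) =
        a * S.coroot j (S.s7alt i j (k + 1) x) - S.coroot i (S.s7alt j i k x) := by
      rw [s7alt_succ, s7_coroot_s, ha]
      conv_lhs => rw [s7alt_succ, s7_coroot_s_self]
      rw [← s7alt_succ]; ring
    have eY : S.coroot j (S.s7alt i j (k + 2) x) =
        b * S.coroot i (S.s7alt j i (k + 1) x) - S.coroot j (S.s7alt i j k x) := by
      rw [s7alt_succ, s7_coroot_s, hb]
      conv_lhs => rw [s7alt_succ, s7_coroot_s_self]
      rw [← s7alt_succ]; ring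
    refine ⟨?_, ?_, ?_, ?_⟩
    · nlinarith [mul_nonneg ha0 h2]
    · nlinarith [mul_nonneg hb0 h1]
    · rw [eX]; nlinarith [mul_le_mul_of_nonneg_left h4 ha0, mul_le_mul_of_nonneg_right hab h1]
    · rw [eY]; nlinarith [mul_le_mul_of_nonneg_left h3 hb0, mul_le_mul_of_nonneg_right hab h2]

/-- Rank two dichotomy. -/
lemma s7_rank2 {i j : Fin m} (hij : i ≠ j) :
    (∀ x k, 0 ≤ S.coroot i x → 0 ≤ S.coroot j x → 0 ≤ S.coroot i (S.s7alt j i k x)) ∨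
    ∃ M, (∀ x, S.s7alt j i (M + 1) x = S.s7alt i j (M + 1) x) ∧
      (∀ x k, k ≤ M → 0 ≤ S.coroot i x → 0 ≤ S.coroot j x →
        0 ≤ S.coroot i (S.s7alt j i k x)) := by
  obtain ⟨a, ha⟩ : ∃ a : ℕ, S.A i j = -(a : ℤ) :=
    ⟨(S.A i j).natAbs, by have := S.A_offdiag i j hij; omega⟩
  obtain ⟨b, hb⟩ : ∃ b : ℕ, S.A j i = -(b : ℤ) :=
    ⟨(S.A j i).natAbs, by have := S.A_offdiag j i hij.symm; omega⟩
  have haR : (S.A i j : ℝ) = -(a : ℝ) := by rw [ha]; push_cast; rfl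
  have hbR : (S.A j i : ℝ) = -(b : ℝ) := by rw [hb]; push_cast; rfl
  by_cases hab : 4 ≤ a * b
  · left
    intro x k hp hq
    exact (S.s7_rank2_inf haR hbR (by positivity) (by positivity)
      (by exact_mod_cast hab) hp hq k).1
  · right
    have h0 : a = 0 ↔ b = 0 := by
      have := S.A_zero_iff i j
      rw [ha, hb] at this
      simpa using this
    have hcases : (a = 0 ∧ b = 0) ∨ (a = 1 ∧ b = 1) ∨ (a = 1 ∧ b = 2) ∨ (a = 2 ∧ b = 1) ∨
        (a = 1 ∧ b = 3) ∨ (a = 3 ∧ b = 1) := by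
      have ha4 : a < 4 := by
        by_contra h
        have : 1 ≤ b := by omega
        nlinarith
      have hb4 : b < 4 := by
        by_contra h
        have : 1 ≤ a := by omega
        nlinarith
      interval_cases a <;> interval_cases b <;> simp_all
    have key : ∀ M, (M = 1 ∧ a = 0 ∧ b = 0) ∨ (M = 2 ∧ a = 1 ∧ b = 1) ∨ (M = 3 ∧ a = 1 ∧ b = 2) ∨
        (M = 3 ∧ a = 2 ∧ b = 1) ∨ (M = 5 ∧ a = 1 ∧ b = 3) ∨ (M = 5 ∧ a = 3 ∧ b = 1) →
      ∃ M, (∀ x, S.s7alt j i (M + 1) x = S.s7alt i j (M + 1) x) ∧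
      (∀ x k, k ≤ M → 0 ≤ S.coroot i x → 0 ≤ S.coroot j x →
        0 ≤ S.coroot i (S.s7alt j i k x)) := by
      intro M hM
      refine ⟨M, fun x => ?_, fun x k hk hp hq => ?_⟩
      · rcases hM with ⟨rfl, rfl, rfl⟩ | ⟨rfl, rfl, rfl⟩ | ⟨rfl, rfl, rfl⟩ | ⟨rfl, rfl, rfl⟩ |
          ⟨rfl, rfl, rfl⟩ | ⟨rfl, rfl, rfl⟩ <;>
        · simp only [s7alt_succ, s7alt_zero, s7_s_apply, map_sub, map_smul, smul_eq_mul,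
            S.pairing, S.A_diag, Int.cast_ofNat, haR, hbR, Nat.cast_zero, Nat.cast_one, Nat.cast_ofNat]
          module
      · rcases hM with ⟨rfl, rfl, rfl⟩ | ⟨rfl, rfl, rfl⟩ | ⟨rfl, rfl, rfl⟩ | ⟨rfl, rfl, rfl⟩ |
          ⟨rfl, rfl, rfl⟩ | ⟨rfl, rfl, rfl⟩ <;> interval_cases k <;>
        · simp only [s7alt_succ, s7alt_zero, s7_coroot_s_self, s7_coroot_s, haR, hbR,
            Nat.cast_zero, Nat.cast_one, Nat.cast_ofNat]
          linarith
    rcases hcases with h | h | h | h | h | h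
    · exact key 1 (by simp [h])
    · exact key 2 (by simp [h])
    · exact key 3 (by simp [h])
    · exact key 3 (by simp [h])
    · exact key 5 (by simp [h])
    · exact key 5 (by simp [h])

lemma s7_tits {I : Set (Fin m)} {μ : V} (hμ : μ ∈ S.chamber) (n : ℕ) :
    ∀ (x : V) (i : Fin m), i ∈ I → S.S7Reach I μ n x → (∀ k < n, ¬ S.S7Reach I μ k x) →
      (∀ k < n, ¬ S.S7Reach I μ k (S.s i x)) → 0 ≤ S.coroot i x := by
  induction n using Nat.strong_induction_on with
  | _ n IH =>
  intro x i hi hx hmin hmin'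
  cases hx with
  | zero => exact hμ i
  | @succ n y j hj hy =>
  have hij : i ≠ j := by
    rintro rfl
    rw [s7_s_s] at hmin'
    exact hmin' n (by omega) hy
  -- maximal alternating prefix
  let P : ℕ → Prop := fun k => ∃ z, S.S7Reach I μ (n - k) z ∧ S.s j y = S.s7alt j i (k + 1) z
  obtain ⟨k, hkn, ⟨z, hz, e⟩, hmax⟩ : ∃ k, k ≤ n ∧ P k ∧ ∀ k', k < k' → k' ≤ n → ¬ P k' := by
    classical
    refine ⟨Nat.findGreatest P n, Nat.findGreatest_le n, ?_, fun k' h1 h2 =>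
      Nat.findGreatest_is_greatest h1 h2⟩
    exact Nat.findGreatest_spec (P := P) (Nat.zero_le n) ⟨y, hy, rfl⟩
  obtain ⟨t, t', ht, e1, e2⟩ := S.s7alt_right k j i
  have hzmin : ∀ r < n - k, ¬ S.S7Reach I μ r z := by
    intro r hr h
    have := S.s7_reach_alt h (k + 1) hj hi
    rw [← e] at this
    exact hmin _ (by omega) this
  have ht1 : ∀ r < n - k, ¬ S.S7Reach I μ r (S.s t z) := by
    intro r hr h
    have := S.s7_reach_alt h k hj hi
    rw [← e1, ← e] at this
    exact hmin _ (by omega) this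
  have ht2 : ∀ r < n - k, ¬ S.S7Reach I μ r (S.s t' z) := by
    intro r hr h
    have e3 := e2 (S.s t' z)
    rw [s7_s_s, ← e] at e3
    have h4 := S.s7_reach_alt h (k + 2) hj hi
    rw [e3] at h4
    have hr' : r = n - (k + 1) := by
      by_contra hne
      exact hmin _ (by omega) h4
    subst hr'
    exact hmax (k + 1) (by omega) (by omega) ⟨_, h, e3.symm⟩
  have hpq : 0 ≤ S.coroot i z ∧ 0 ≤ S.coroot j z := by
    rcases ht with ⟨rfl, rfl⟩ | ⟨rfl, rfl⟩
    · exact ⟨IH _ (by omega) z _ hi hz hzmin ht2, IH _ (by omega) z _ hj hz hzmin ht1⟩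
    · exact ⟨IH _ (by omega) z _ hi hz hzmin ht1, IH _ (by omega) z _ hj hz hzmin ht2⟩
  rw [e]
  rcases S.s7_rank2 hij with h | ⟨M, hbraid, h⟩
  · exact h z _ hpq.1 hpq.2
  · by_cases hkM : k + 1 ≤ M
    · exact h z _ hkM hpq.1 hpq.2
    · exfalso
      obtain ⟨r, hr⟩ : ∃ r, k = M + r := ⟨k - M, by omega⟩
      obtain ⟨i', j', hi'j', e5⟩ := S.s7alt_add (M + 1) r z j i
      have hi' : i' ∈ I := by rcases hi'j' with ⟨rfl, rfl⟩ | ⟨rfl, rfl⟩ <;> assumption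
      have hj' : j' ∈ I := by rcases hi'j' with ⟨rfl, rfl⟩ | ⟨rfl, rfl⟩ <;> assumption
      have h6 := S.s7_reach_alt (S.s7_reach_alt hz r hi' hj') M hj hi
      have e6 : S.s i (S.s j y) = S.s7alt j i M (S.s7alt i' j' r z) := by
        rw [e, show k + 1 = M + 1 + r by omega, e5, hbraid, s7alt_succ, s7_s_s]
      rw [← e6] at h6
      exact hmin' _ (by omega) h6

lemma s7_exists_min {I : Set (Fin m)} {μ x : V} (h : ∃ n, S.S7Reach I μ n x) :
    ∃ n, S.S7Reach I μ n x ∧ ∀ k < n, ¬ S.S7Reach I μ k x := by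
  classical
  exact ⟨Nat.find h, Nat.find_spec h, fun k hk => Nat.find_min h hk⟩

lemma s7_reach_orbit {I : Set (Fin m)} {μ : V} (w : V ≃ₗ[ℝ] V) (hw : w ∈ S.WI I) :
    ∃ n, S.S7Reach I μ n (w μ) := by
  unfold WI at hw
  induction hw using Subgroup.closure_induction_left with
  | one => exact ⟨0, S7Reach.zero⟩
  | mul_left x hx y hy ih =>
    obtain ⟨i, hi, rfl⟩ := hx
    obtain ⟨n, hn⟩ := ih
    exact ⟨n + 1, S7Reach.succ i hi hn⟩
  | inv_mul_cancel x hx y hy ih =>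
    obtain ⟨i, hi, rfl⟩ := hx
    obtain ⟨n, hn⟩ := ih
    refine ⟨n + 1, ?_⟩
    have e : (S.s i)⁻¹ = S.s i := by
      rw [inv_eq_iff_mul_eq_one]
      ext v
      exact S.s7_s_s i v
    rw [e]
    exact S7Reach.succ i hi hn

lemma s7_reach_mono {K K' : Set (Fin m)} (h : K ⊆ K') {i j : K}
    (hr : (S.diagram.induce K).Reachable i j) :
    (S.diagram.induce K').Reachable ⟨i, h i.2⟩ ⟨j, h j.2⟩ :=
  hr.map (SimpleGraph.induceHomOfLE S.diagram h).toHom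

lemma s7_union {μ : V} {K K' : Set (Fin m)} (h : S.MuConnected μ K) (h' : S.MuConnected μ K') :
    S.MuConnected μ (K ∪ K') := by
  rintro ⟨i, hi | hi⟩
  · obtain ⟨j, hj, hr⟩ := h ⟨i, hi⟩
    exact ⟨⟨j, Or.inl j.2⟩, hj, S.s7_reach_mono subset_union_left hr⟩
  · obtain ⟨j, hj, hr⟩ := h' ⟨i, hi⟩
    exact ⟨⟨j, Or.inr j.2⟩, hj, S.s7_reach_mono subset_union_right hr⟩

lemma s7_insert {μ : V} {K : Set (Fin m)} (h : S.MuConnected μ K) (i : Fin m)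
    (hi : S.coroot i μ ≠ 0 ∨ ∃ k ∈ K, S.diagram.Adj i k) :
    S.MuConnected μ (insert i K) := by
  rintro ⟨l, hl⟩
  have hsub : K ⊆ insert i K := subset_insert i K
  rcases hl with rfl | hl
  · rcases hi with hi | ⟨k, hk, hadj⟩
    · exact ⟨⟨l, Or.inl rfl⟩, hi, SimpleGraph.Reachable.refl _⟩
    · obtain ⟨j, hj, hr⟩ := h ⟨k, hk⟩
      refine ⟨⟨j, hsub j.2⟩, hj, SimpleGraph.Reachable.trans ?_ (S.s7_reach_mono hsub hr)⟩
      apply SimpleGraph.Adj.reachable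
      exact hadj
  · obtain ⟨j, hj, hr⟩ := h ⟨l, hl⟩
    exact ⟨⟨j, hsub j.2⟩, hj, S.s7_reach_mono hsub hr⟩

/-- Vectors `μ - ∑ c α` with `c ≥ 0` of `μ`-connected support in `I`. -/
def s7T (μ : V) (I : Set (Fin m)) : Set V :=
  {x | ∃ c : Fin m → ℝ, (∀ i, 0 ≤ c i) ∧ {i | c i ≠ 0} ⊆ I ∧ S.MuConnected μ {i | c i ≠ 0} ∧
    x = μ - ∑ i, c i • S.root i}

lemma s7_reach_T {I : Set (Fin m)} {μ : V} (hμ : μ ∈ S.chamber) (n : ℕ) :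
    ∀ x, S.S7Reach I μ n x → (∀ k < n, ¬ S.S7Reach I μ k x) → x ∈ S.s7T μ I := by
  induction n with
  | zero =>
    intro x hx _
    cases hx
    refine ⟨fun _ => 0, by simp, by simp, ?_, by simp⟩
    rintro ⟨i, hi⟩
    simp at hi
  | succ n ih =>
    intro x hx hmin
    cases hx with
    | @succ _ y i hi hy =>
    have hymin : ∀ k < n, ¬ S.S7Reach I μ k y := fun k hk h =>
      hmin (k + 1) (by omega) (S7Reach.succ i hi h)
    have hpos : 0 ≤ S.coroot i y :=
      S.s7_tits hμ n y i hi hy hymin (fun k hk => hmin k (by omega))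
    obtain ⟨c, hc0, hcI, hcon, e⟩ := ih y hy hymin
    rcases hpos.eq_or_lt with h0 | hlt
    · rw [s7_s_apply, ← h0, zero_smul, sub_zero]
      exact ⟨c, hc0, hcI, hcon, e⟩
    · have hsupp : {l | (c + Pi.single i (S.coroot i y) : Fin m → ℝ) l ≠ 0} = insert i {l | c l ≠ 0} := by
        ext l
        simp only [Pi.add_apply, mem_setOf_eq, mem_insert_iff]
        by_cases hl : l = i
        · subst hl
          simp only [Pi.single_eq_same, true_or, iff_true]
          have := hc0 l
          positivity
        · simp [hl]
      refine ⟨c + Pi.single i (S.coroot i y), ?_, ?_, ?_, ?_⟩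
      · intro l
        have : 0 ≤ (Pi.single i (S.coroot i y) : Fin m → ℝ) l := by
          by_cases hl : l = i
          · subst hl; simpa using hpos
          · simp [hl]
        exact add_nonneg (hc0 l) this
      · rw [hsupp]; exact insert_subset hi hcI
      · rw [hsupp]
        by_cases hiK : c i ≠ 0
        · rwa [insert_eq_of_mem (show i ∈ {l | c l ≠ 0} from hiK)]
        · apply S.s7_insert hcon
          by_contra hneg
          push Not at hneg hiK
          obtain ⟨h1, h2⟩ := hneg
          have : S.coroot i y = 0 := by
            rw [e, map_sub, h1, map_sum, zero_sub, neg_eq_zero]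
            apply Finset.sum_eq_zero
            intro l _
            rw [map_smul, S.pairing, smul_eq_mul]
            by_cases hl : c l = 0
            · simp [hl]
            · have hne : i ≠ l := by rintro rfl; exact hl hiK
              have hA : S.A i l = 0 := by
                by_contra hA
                exact h2 l hl ⟨hne, hA, fun h => hA ((S.A_zero_iff i l).2 h)⟩
              simp [hA]
          linarith
      · rw [s7_s_apply]
        simp only [Pi.add_apply, add_smul, Finset.sum_add_distrib]
        have : ∑ l, (Pi.single i (S.coroot i y) : Fin m → ℝ) l • S.root l
            = S.coroot i y • S.root i := by
          rw [Finset.sum_eq_single i]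
          · simp
          · intro l _ hl; simp [hl]
          · simp
        rw [this, ← sub_sub, ← e]

lemma s7_T_convex (μ : V) (I : Set (Fin m)) : Convex ℝ (S.s7T μ I) := by
  rw [convex_iff_forall_pos]
  rintro x ⟨c, hc, hcI, hcon, rfl⟩ y ⟨d, hd, hdI, hdon, rfl⟩ a b ha hb hab
  have hsupp : {l | a * c l + b * d l ≠ 0} = {l | c l ≠ 0} ∪ {l | d l ≠ 0} := by
    ext l
    simp only [mem_setOf_eq, mem_union]
    have h1 := mul_nonneg ha.le (hc l)
    have h2 := mul_nonneg hb.le (hd l)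
    rw [Ne, add_eq_zero_iff_of_nonneg h1 h2]
    simp only [mul_eq_zero, ha.ne', hb.ne', false_or]
    tauto
  refine ⟨fun l => a * c l + b * d l, fun l => ?_, ?_, ?_, ?_⟩
  · exact add_nonneg (mul_nonneg ha.le (hc l)) (mul_nonneg hb.le (hd l))
  · rw [hsupp]; exact union_subset hcI hdI
  · rw [hsupp]; exact S.s7_union hcon hdon
  · simp only [add_smul, mul_smul, Finset.sum_add_distrib, ← Finset.smul_sum]
    obtain rfl : b = 1 - a := by linarith
    module

end GCMRealization

open GCMRealization in
theorem statement_7 {m : ℕ} {V : Type*} [NormedAddCommGroup V] [NormedSpace ℝ V]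
    (S : GCMRealization m V) (μ : V) (hμ : μ ∈ S.chamber)
    (I : Set (Fin m)) (hcon : S.MuConnected μ I) :
    (S.face μ I ⊆
      ⋃ K ∈ {K : Set (Fin m) | K ⊆ I ∧ S.MuConnected μ K},
        (fun v => μ - v) '' S.conePos K) ∧
    (∀ K K' : Set (Fin m), K ≠ K' →
      Disjoint ((fun v => μ - v) '' S.conePos K) ((fun v => μ - v) '' S.conePos K')) := by
  constructor
  · have h1 : S.face μ I ⊆ S.s7T μ I := by
      apply convexHull_min _ (S.s7_T_convex μ I)
      rintro _ ⟨w, hw, rfl⟩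
      obtain ⟨n, hn, hmin⟩ := S.s7_exists_min (S.s7_reach_orbit (μ := μ) w hw)
      exact S.s7_reach_T hμ n _ hn hmin
    intro x hx
    obtain ⟨c, hc0, hcI, hcc, e⟩ := h1 hx
    simp only [mem_iUnion]
    refine ⟨{i | c i ≠ 0}, ⟨hcI, hcc⟩, ∑ i, c i • S.root i, ⟨c, ?_, ?_, rfl⟩, e.symm⟩
    · intro i hi
      exact lt_of_le_of_ne (hc0 i) (Ne.symm hi)
    · intro i hi
      simpa using hi
  · intro K K' hne
    rw [Set.disjoint_left]
    rintro _ ⟨v, ⟨c, hc, hc', rfl⟩, rfl⟩ ⟨v', ⟨d, hd, hd', rfl⟩, e⟩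
    apply hne
    have e' : ∑ i, (d i - c i) • S.root i = 0 := by
      simp only [sub_smul, Finset.sum_sub_distrib]
      rw [sub_eq_zero]
      exact sub_right_injective e
    have hcd : ∀ i, d i = c i := fun i =>
      sub_eq_zero.1 (Fintype.linearIndependent_iff.1 S.root_indep _ e' i)
    ext i
    constructor
    · intro hi
      by_contra h
      have := hc i hi
      rw [← hcd, hd' i h] at this
      exact lt_irrefl _ this
    · intro hi
      by_contra h
      have := hd i hi
      rw [hcd, hc' i h] at this
      exact lt_irrefl _ this
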